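/- (Korn-type inequality on the flattened half space) Suppose φ on ℝ³₋ satisfies ∂_zφ ≥ c₀ > 0 and ‖∇φ‖_{L^∞} + ‖∇²φ‖_{L^∞} ≤ 1/c₀. Then there exists Λ₀ = Λ(1/c₀) > 0 such that for every vector field v ∈ H¹(ℝ³₋), ‖∇v‖²_{L²(ℝ³₋)} ≤ Λ₀ ( ∫_{ℝ³₋} |S^φ v|² ∂_zφ dy dz + ‖v‖²_{L²(ℝ³₋)} ). -/

import Mathlib

open MeasureTheory

/-- The plain partial derivative `∂_i g` on `ℝ³`. -/
noncomputable def pd (g : (Fin 3 → ℝ) → ℝ) (i : Fin 3) (x : Fin 3 → ℝ) : ℝ :=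
  fderiv ℝ g x (Pi.single i 1)

/-- The flattened derivative `∂_i^φ`. -/
noncomputable def pdF (φ g : (Fin 3 → ℝ) → ℝ) (i : Fin 3) (x : Fin 3 → ℝ) : ℝ :=
  if i = 2 then pd g 2 x / pd φ 2 x
  else pd g i x - pd φ i x / pd φ 2 x * pd g 2 x

/-- The entries of the flattened symmetric gradient `S^φ v`. -/
noncomputable def symF (φ : (Fin 3 → ℝ) → ℝ) (v : (Fin 3 → ℝ) → Fin 3 → ℝ)
    (i j : Fin 3) (x : Fin 3 → ℝ) : ℝ :=
  (pdF φ (fun y => v y j) i x + pdF φ (fun y => v y i) j x) / 2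

/-- The lower half space `ℝ³₋`. -/
def lowerHalf : Set (Fin 3 → ℝ) := {x | x 2 < 0}

/-! ### Partial derivatives -/

lemma pd_continuous {f : (Fin 3 → ℝ) → ℝ} (hf : ContDiff ℝ 1 f) (i : Fin 3) :
    Continuous (pd f i) :=
  (hf.continuous_fderiv (by norm_num)).clm_apply continuous_const

lemma pd_add {f g : (Fin 3 → ℝ) → ℝ} (hf : ContDiff ℝ 1 f) (hg : ContDiff ℝ 1 g) (i : Fin 3)
    (x : Fin 3 → ℝ) : pd (fun y => f y + g y) i x = pd f i x + pd g i x := by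
  unfold pd
  rw [fderiv_fun_add (hf.differentiable (by norm_num) x) (hg.differentiable (by norm_num) x)]
  rfl

lemma pd_const_mul {f : (Fin 3 → ℝ) → ℝ} (hf : ContDiff ℝ 1 f) (c : ℝ) (i : Fin 3)
    (x : Fin 3 → ℝ) : pd (fun y => c * f y) i x = c * pd f i x := by
  unfold pd
  rw [fderiv_const_mul (hf.differentiable (by norm_num) x)]
  rfl

lemma pd_mul {f g : (Fin 3 → ℝ) → ℝ} (hf : ContDiff ℝ 1 f) (hg : ContDiff ℝ 1 g) (i : Fin 3)
    (x : Fin 3 → ℝ) : pd (fun y => f y * g y) i x = f x * pd g i x + pd f i x * g x := by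
  unfold pd
  rw [fderiv_fun_mul (hf.differentiable (by norm_num) x) (hg.differentiable (by norm_num) x)]
  simp [mul_comm]

lemma pd_comp_clm {f : (Fin 3 → ℝ) → ℝ} (hf : ContDiff ℝ 1 f)
    (L : (Fin 3 → ℝ) →L[ℝ] (Fin 3 → ℝ)) (i : Fin 3) (x : Fin 3 → ℝ) :
    pd (fun y => f (L y)) i x = fderiv ℝ f (L x) (L (Pi.single i 1)) := by
  unfold pd
  have := ((hf.differentiable (by norm_num) (L x)).hasFDerivAt.comp x L.hasFDerivAt).fderiv
  rw [show (fun y => f (L y)) = f ∘ L from rfl, this]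
  rfl

lemma pd_comp_add {f : (Fin 3 → ℝ) → ℝ} (a : Fin 3 → ℝ) (i : Fin 3) (x : Fin 3 → ℝ) :
    pd (fun y => f (y + a)) i x = pd f i (x + a) := by
  unfold pd
  rw [fderiv_comp_add_right]

lemma pd_hasCompactSupport {f : (Fin 3 → ℝ) → ℝ} (hf : HasCompactSupport f) (i : Fin 3) :
    HasCompactSupport (pd f i) := by
  have := hf.fderiv ℝ
  exact this.comp_left (g := fun l : (Fin 3 → ℝ) →L[ℝ] ℝ => l (Pi.single i 1)) (by simp)

lemma norm_single_one (i : Fin 3) : ‖(Pi.single i 1 : Fin 3 → ℝ)‖ = 1 := by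
  rw [Pi.norm_single]; simp

lemma lowerHalf_measurable : MeasurableSet lowerHalf :=
  measurableSet_lt (measurable_pi_apply 2) measurable_const

/-- the measure on the half space -/
noncomputable abbrev muH : Measure (Fin 3 → ℝ) := volume.restrict lowerHalf

/-- difference quotients converge -/
lemma diffQuot_tendsto {f : (Fin 3 → ℝ) → ℝ} (hf : ContDiff ℝ 1 f) (i : Fin 3) (x : Fin 3 → ℝ)
    {h : ℕ → ℝ} (hh : Filter.Tendsto h Filter.atTop (nhdsWithin 0 {0}ᶜ)) :
    Filter.Tendsto (fun n => (f (x + h n • Pi.single i 1) - f x) / h n) Filter.atTop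
      (nhds (pd f i x)) := by
  have h1 : HasLineDerivAt ℝ f (pd f i x) x (Pi.single i 1) :=
    (hf.differentiable (by norm_num) x).hasFDerivAt.hasLineDerivAt _
  have h2 := h1.tendsto_slope_zero.comp hh
  refine h2.congr fun n => ?_
  simp [div_eq_inv_mul]

lemma lip_bound {f : (Fin 3 → ℝ) → ℝ} (hf : ContDiff ℝ 1 f) (hc : HasCompactSupport f) :
    ∃ K : ℝ, 0 ≤ K ∧ (∀ x y, |f x - f y| ≤ K * ‖x - y‖) ∧ ∀ i x, |pd f i x| ≤ K := by
  obtain ⟨C, hC⟩ := hf.lipschitzWith_of_hasCompactSupport hc (by norm_num)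
  refine ⟨C, C.2, fun x y => ?_, fun i x => ?_⟩
  · simpa [Real.norm_eq_abs] using hC.norm_sub_le x y
  · have := (fderiv ℝ f x).le_opNorm (Pi.single i 1)
    rw [norm_single_one, mul_one] at this
    exact this.trans (norm_fderiv_le_of_lipschitz ℝ hC)

lemma diffQuot_bound {f : (Fin 3 → ℝ) → ℝ} {K : ℝ} (hK0 : 0 ≤ K)
    (hK : ∀ x y, |f x - f y| ≤ K * ‖x - y‖) (i : Fin 3) (x : Fin 3 → ℝ) (h : ℝ) :
    |(f (x + h • Pi.single i 1) - f x) / h| ≤ K := by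
  rw [abs_div]
  apply div_le_of_le_mul₀ (abs_nonneg _) hK0
  have := hK (x + h • Pi.single i 1) x
  simpa [norm_smul, norm_single_one] using this

/-- translations in tangential directions preserve the half space integral -/
lemma integral_shift (k : (Fin 3 → ℝ) → ℝ) (a : Fin 3) (ha : a ≠ 2) (h : ℝ) :
    ∫ x, k (x + h • Pi.single a 1) ∂muH = ∫ x, k x ∂muH := by
  rw [← integral_indicator lowerHalf_measurable, ← integral_indicator lowerHalf_measurable,
    ← integral_add_right_eq_self (lowerHalf.indicator k) (h • (Pi.single a 1 : Fin 3 → ℝ))]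
  congr 1
  ext x
  have : x + h • Pi.single a 1 ∈ lowerHalf ↔ x ∈ lowerHalf := by
    simp [lowerHalf, ha.symm]
  by_cases hx : x ∈ lowerHalf
  · simp only [Set.indicator, hx, this.2 hx, if_true]
  · have h2 := mt this.1 hx
    simp only [Set.indicator, hx, h2, if_false]

lemma hseq_tendsto : Filter.Tendsto (fun n : ℕ => (1 : ℝ) / (n + 1)) Filter.atTop
    (nhdsWithin 0 {0}ᶜ) := by
  apply tendsto_nhdsWithin_of_tendsto_nhds_of_eventually_within _
    tendsto_one_div_add_atTop_nhds_zero_nat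
  exact Filter.Eventually.of_forall fun n => by
    have : (0 : ℝ) < 1 / (n + 1) := Nat.one_div_pos_of_nat
    exact this.ne'

/-- dominated convergence for difference quotients -/
lemma integral_diffQuot_tendsto {f G : (Fin 3 → ℝ) → ℝ} (hf : ContDiff ℝ 1 f)
    (hfc : HasCompactSupport f) (hG : Continuous G) (hGc : HasCompactSupport G) (i : Fin 3)
    {h : ℕ → ℝ} (hh : Filter.Tendsto h Filter.atTop (nhdsWithin 0 {0}ᶜ)) :
    Filter.Tendsto (fun n => ∫ x, (f (x + h n • Pi.single i 1) - f x) / h n * G x ∂muH)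
      Filter.atTop (nhds (∫ x, pd f i x * G x ∂muH)) := by
  obtain ⟨K, hK0, hK, -⟩ := lip_bound hf hfc
  have hfcont := hf.continuous
  apply tendsto_integral_of_dominated_convergence (fun x => K * |G x|)
  · intro n
    apply Continuous.aestronglyMeasurable
    fun_prop
  · have := (hG.integrable_of_hasCompactSupport hGc (μ := muH)).abs.const_mul K
    exact this
  · intro n
    refine Filter.Eventually.of_forall fun x => ?_
    rw [Real.norm_eq_abs, abs_mul]
    exact mul_le_mul_of_nonneg_right (diffQuot_bound hK0 hK i x _) (abs_nonneg _)
  · exact Filter.Eventually.of_forall fun x => (diffQuot_tendsto hf i x hh).mul_const _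

/-- integrable: product of compactly supported continuous functions, with shift -/
lemma intg_cc {u g : (Fin 3 → ℝ) → ℝ} (hu : Continuous u) (hg : Continuous g)
    (hgc : HasCompactSupport g) (μ : Measure (Fin 3 → ℝ)) [IsLocallyFiniteMeasure μ] :
    Integrable (fun x => u x * g x) μ :=
  (hu.mul hg).integrable_of_hasCompactSupport (hgc.mul_left)

lemma hseq_neg_tendsto : Filter.Tendsto (fun n : ℕ => -((1 : ℝ) / (n + 1))) Filter.atTop
    (nhdsWithin 0 {0}ᶜ) := by
  apply tendsto_nhdsWithin_of_tendsto_nhds_of_eventually_within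
  · simpa using (tendsto_one_div_add_atTop_nhds_zero_nat (𝕜 := ℝ)).neg
  exact Filter.Eventually.of_forall fun n => by
    have : (0 : ℝ) < 1 / (n + 1) := Nat.one_div_pos_of_nat
    exact (neg_neg_of_pos this).ne

/-- discrete integration by parts, tangential -/
lemma discrete_parts {u g : (Fin 3 → ℝ) → ℝ} (hu : Continuous u) (huc : HasCompactSupport u)
    (hg : Continuous g) (hgc : HasCompactSupport g) (a : Fin 3) (ha : a ≠ 2) (h : ℝ) :
    ∫ x, (u (x + h • Pi.single a 1) - u x) / h * g x ∂muH
      = - ∫ x, (g (x + (-h) • Pi.single a 1) - g x) / (-h) * u x ∂muH := by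
  have e1 : ∫ x, u (x + h • Pi.single a 1) * g x ∂muH
      = ∫ x, g (x + (-h) • Pi.single a 1) * u x ∂muH := by
    refine Eq.trans ?_ (integral_shift (fun x => g (x + (-h) • Pi.single a 1) * u x) a ha h)
    congr 1
    ext x
    rw [add_assoc, ← add_smul]
    simp [mul_comm]
  have i1 : Integrable (fun x => u (x + h • Pi.single a 1) * g x) muH :=
    intg_cc (by fun_prop) hg hgc _
  have i2 : Integrable (fun x => u x * g x) muH := intg_cc hu hg hgc _
  have i3 : Integrable (fun x => g (x + (-h) • Pi.single a 1) * u x) muH :=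
    intg_cc (by fun_prop) hu huc _
  have l : (fun x => (u (x + h • Pi.single a 1) - u x) / h * g x)
      = fun x => h⁻¹ * (u (x + h • Pi.single a 1) * g x - u x * g x) := by
    ext x; ring
  have r : (fun x => (g (x + (-h) • Pi.single a 1) - g x) / (-h) * u x)
      = fun x => -h⁻¹ * (g (x + (-h) • Pi.single a 1) * u x - u x * g x) := by
    ext x; ring
  rw [l, r, integral_const_mul, integral_const_mul, integral_sub i1 i2, integral_sub i3 i2, e1]
  ring

lemma parts_tangential {u g : (Fin 3 → ℝ) → ℝ} (hu : ContDiff ℝ 1 u) (huc : HasCompactSupport u)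
    (hg : ContDiff ℝ 1 g) (hgc : HasCompactSupport g) (a : Fin 3) (ha : a ≠ 2) :
    ∫ x, pd u a x * g x ∂muH = - ∫ x, pd g a x * u x ∂muH := by
  have h1 := integral_diffQuot_tendsto hu huc hg.continuous hgc a hseq_tendsto
  have h2 := (integral_diffQuot_tendsto hg hgc hu.continuous huc a hseq_neg_tendsto).neg
  refine tendsto_nhds_unique h1 (h2.congr fun n => ?_)
  exact (discrete_parts hu.continuous huc hg.continuous hgc a ha _).symm

lemma parts_normal {u g : (Fin 3 → ℝ) → ℝ} (hu : ContDiff ℝ 1 u) (huc : HasCompactSupport u)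
    (hg : ContDiff ℝ 1 g) (hgc : HasCompactSupport g) (hg0 : ∀ x, x 2 = 0 → g x = 0) :
    ∫ x, pd u 2 x * g x ∂muH = - ∫ x, pd g 2 x * u x ∂muH := by
  have h1 := integral_diffQuot_tendsto hu huc hg.continuous hgc 2 hseq_neg_tendsto
  set e : Fin 3 → ℝ := Pi.single 2 1 with he
  set G : (Fin 3 → ℝ) → ℝ := lowerHalf.indicator g with hG
  have hucont := hu.continuous
  have hgcont := hg.continuous
  obtain ⟨K, hK0, hK, -⟩ := lip_bound hg hgc
  have hbd : ∀ x, ∀ t : ℝ, 0 < t → |(G (x + t • e) - G x) / t| ≤ K := by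
    intro x t ht
    by_cases hx : x 2 + t < 0
    · have m1 : x ∈ lowerHalf := by simp only [lowerHalf, Set.mem_ofPred_eq]; linarith
      have m2 : x + t • e ∈ lowerHalf := by simpa [lowerHalf, he] using hx
      rw [hG, Set.indicator_of_mem m1, Set.indicator_of_mem m2]
      exact diffQuot_bound hK0 hK 2 x t
    · have m2 : x + t • e ∉ lowerHalf := by simpa [lowerHalf, he] using hx
      by_cases hx1 : x 2 < 0
      · have m1 : x ∈ lowerHalf := hx1
        rw [hG, Set.indicator_of_mem m1, Set.indicator_of_notMem m2, abs_div, abs_of_pos ht,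
          div_le_iff₀ ht]
        have h3 := hK x (x + (-x 2) • e)
        rw [hg0 (x + (-x 2) • e) (by simp [he])] at h3
        have h4 : ‖x - (x + (-x 2) • e)‖ = - x 2 := by
          rw [sub_add_cancel_left, norm_neg, norm_smul, he, norm_single_one, Real.norm_eq_abs,
            mul_one, abs_of_pos (by linarith)]
        rw [h4] at h3
        rw [zero_sub, abs_neg]
        rw [sub_zero] at h3
        refine h3.trans (mul_le_mul_of_nonneg_left ?_ hK0)
        linarith
      · have m1 : x ∉ lowerHalf := hx1
        rw [hG, Set.indicator_of_notMem m1, Set.indicator_of_notMem m2]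
        simpa using hK0
  have hlim : ∀ x, Filter.Tendsto (fun n : ℕ => (G (x + ((1 : ℝ) / (n + 1)) • e) - G x) /
      ((1 : ℝ) / (n + 1))) Filter.atTop (nhds (lowerHalf.indicator (pd g 2) x)) := by
    intro x
    by_cases hx : x ∈ lowerHalf
    · rw [Set.indicator_of_mem hx]
      refine (diffQuot_tendsto hg 2 x hseq_tendsto).congr' ?_
      have hx' : x 2 < 0 := hx
      have : ∀ᶠ n : ℕ in Filter.atTop, (1 : ℝ) / (n + 1) < - x 2 :=
        (tendsto_one_div_add_atTop_nhds_zero_nat (𝕜 := ℝ)).eventually_lt_const (by linarith)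
      filter_upwards [this] with n hn
      have m2 : x + ((1 : ℝ) / (n + 1)) • e ∈ lowerHalf := by
        simp only [lowerHalf, he, Set.mem_ofPred_eq, Pi.add_apply, Pi.smul_apply, Pi.single_eq_same,
          smul_eq_mul, mul_one]
        linarith
      rw [hG, Set.indicator_of_mem hx, Set.indicator_of_mem m2]
    · rw [Set.indicator_of_notMem hx]
      refine tendsto_const_nhds.congr fun n => ?_
      have hx' : 0 ≤ x 2 := not_lt.1 hx
      have hp : (0 : ℝ) < 1 / (n + 1) := Nat.one_div_pos_of_nat
      have m2 : x + ((1 : ℝ) / (n + 1)) • e ∉ lowerHalf := by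
        simp only [lowerHalf, he, Set.mem_ofPred_eq, Pi.add_apply, Pi.smul_apply, Pi.single_eq_same,
          smul_eq_mul, mul_one]
        linarith
      rw [hG, Set.indicator_of_notMem hx, Set.indicator_of_notMem m2]
      simp
  have hGm : Measurable G := hg.continuous.measurable.indicator lowerHalf_measurable
  have h2 : Filter.Tendsto (fun n : ℕ => ∫ x, (G (x + ((1 : ℝ) / (n + 1)) • e) - G x) /
      ((1 : ℝ) / (n + 1)) * u x) Filter.atTop
      (nhds (∫ x, lowerHalf.indicator (pd g 2) x * u x)) := by
    apply tendsto_integral_of_dominated_convergence (fun x => K * |u x|)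
    · intro n
      apply Measurable.aestronglyMeasurable
      have := hucont.measurable
      fun_prop
    · exact (hucont.integrable_of_hasCompactSupport huc).abs.const_mul K
    · intro n
      refine Filter.Eventually.of_forall fun x => ?_
      rw [Real.norm_eq_abs, abs_mul]
      exact mul_le_mul_of_nonneg_right (hbd x _ Nat.one_div_pos_of_nat) (abs_nonneg _)
    · exact Filter.Eventually.of_forall fun x => (hlim x).mul_const _
  have h3 : ∫ x, lowerHalf.indicator (pd g 2) x * u x = ∫ x, pd g 2 x * u x ∂muH := by
    rw [← integral_indicator lowerHalf_measurable]
    congr 1; ext x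
    by_cases hx : x ∈ lowerHalf <;> simp [Set.indicator, hx]
  rw [h3] at h2
  refine tendsto_nhds_unique h1 (h2.neg.congr fun n => ?_)
  have hp : (0 : ℝ) < 1 / (n + 1) := Nat.one_div_pos_of_nat
  generalize (1 : ℝ) / (n + 1) = t at hp
  have i2 : Integrable (fun x => u x * G x) := by
    have := (intg_cc hucont hgcont hgc volume).indicator lowerHalf_measurable
    refine this.congr (Filter.Eventually.of_forall fun x => ?_)
    by_cases hx : x ∈ lowerHalf <;> simp [Set.indicator, hx, hG]
  have i1 : Integrable (fun x => u (x + (-t) • e) * G x) := by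
    have := (intg_cc (u := fun x => u (x + (-t) • e)) (by fun_prop) hgcont hgc volume).indicator
      lowerHalf_measurable
    refine this.congr (Filter.Eventually.of_forall fun x => ?_)
    by_cases hx : x ∈ lowerHalf <;> simp [Set.indicator, hx, hG]
  have e1 : ∫ x, u (x + (-t) • e) * G x = ∫ x, G (x + t • e) * u x := by
    rw [← integral_add_right_eq_self (fun x => u (x + (-t) • e) * G x) (t • e)]
    congr 1; ext x
    rw [add_assoc, ← add_smul]
    simp [mul_comm]
  have i3 : Integrable (fun x => G (x + t • e) * u x) := by
    have := i1.comp_add_right (t • e)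
    refine this.congr (Filter.Eventually.of_forall fun x => ?_)
    dsimp only
    rw [add_assoc, ← add_smul]
    simp [mul_comm]
  have l : ∫ x, (u (x + (-t) • e) - u x) / (-t) * g x ∂muH
      = ∫ x, -t⁻¹ * (u (x + (-t) • e) * G x - u x * G x) := by
    rw [← integral_indicator lowerHalf_measurable]
    congr 1; ext x
    by_cases hx : x ∈ lowerHalf
    · simp only [Set.indicator, hx, hG, if_true]; ring
    · simp [Set.indicator, hx, hG]
  have r : (fun x => (G (x + t • e) - G x) / t * u x)
      = fun x => t⁻¹ * (G (x + t • e) * u x - u x * G x) := by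
    ext x; ring
  rw [l, r, integral_const_mul, integral_const_mul, integral_sub i1 i2, integral_sub i3 i2, e1]
  ring

/-- the antisymmetric form vanishes, compactly supported case -/
lemma form_zero_cc {f g : (Fin 3 → ℝ) → ℝ} (hf : ContDiff ℝ 1 f) (hfc : HasCompactSupport f)
    (hg : ContDiff ℝ 1 g) (hgc : HasCompactSupport g) (a b : Fin 3) (ha : a ≠ 2)
    (hb : b ≠ 2 ∨ ∀ x, x 2 = 0 → g x = 0) :
    ∫ x, pd f a x * pd g b x ∂muH = ∫ x, pd g a x * pd f b x ∂muH := by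
  have h1 := integral_diffQuot_tendsto hf hfc (pd_continuous hg b) (pd_hasCompactSupport hgc b) a
    hseq_tendsto
  have h2 := integral_diffQuot_tendsto hg hgc (pd_continuous hf b) (pd_hasCompactSupport hfc b) a
    hseq_neg_tendsto
  refine tendsto_nhds_unique h1 (h2.congr fun n => ?_)
  generalize (1 : ℝ) / (n + 1) = t
  have hu : ContDiff ℝ 1 (fun x => (f (x + t • Pi.single a 1) - f x) / t) :=
    ((hf.comp (contDiff_id.add contDiff_const)).sub hf).div_const t
  have hfc' : HasCompactSupport (fun x => f (x + t • Pi.single a 1)) :=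
    hfc.comp_homeomorph (Homeomorph.addRight (t • Pi.single a 1))
  have huc : HasCompactSupport (fun x => (f (x + t • Pi.single a 1) - f x) / t) := by
    have := (hfc'.sub hfc).mul_right (f' := fun _ => t⁻¹)
    exact this
  have hpd : ∀ x, pd (fun x => (f (x + t • Pi.single a 1) - f x) / t) b x
      = (pd f b (x + t • Pi.single a 1) - pd f b x) / t := by
    intro x
    have : (fun x => (f (x + t • Pi.single a 1) - f x) / t)
        = fun x => t⁻¹ * (f (x + t • Pi.single a 1) + (-1) * f x) := by ext x; ring
    have c1 : ContDiff ℝ 1 (fun x => f (x + t • Pi.single a 1)) :=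
      hf.comp (contDiff_id.add contDiff_const)
    have c2 : ContDiff ℝ 1 (fun x => (-1) * f x) := contDiff_const.mul hf
    rw [this, pd_const_mul (c1.add c2), pd_add c1 c2, pd_const_mul hf, pd_comp_add]
    ring
  have key : ∫ x, pd (fun x => (f (x + t • Pi.single a 1) - f x) / t) b x * g x ∂muH
      = - ∫ x, pd g b x * ((f (x + t • Pi.single a 1) - f x) / t) ∂muH := by
    by_cases hb2 : b = 2
    · subst hb2
      exact parts_normal hu huc hg hgc (hb.resolve_left (by simp))
    · exact parts_tangential hu huc hg hgc b hb2
  simp_rw [hpd] at key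
  rw [discrete_parts (pd_continuous hf b) (pd_hasCompactSupport hfc b) hg.continuous hgc a ha t,
    neg_inj] at key
  rw [key]
  congr 1; ext x; ring

/-- `C¹` functions which are `H¹` on the half space -/
structure IsH1 (f : (Fin 3 → ℝ) → ℝ) : Prop where
  c1 : ContDiff ℝ 1 f
  l2 : MemLp f 2 muH
  d2 : ∀ i, MemLp (pd f i) 2 muH

lemma IsH1.add {f g : (Fin 3 → ℝ) → ℝ} (hf : IsH1 f) (hg : IsH1 g) :
    IsH1 (fun x => f x + g x) :=
  ⟨hf.c1.add hg.c1, hf.l2.add hg.l2, fun i => by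
    have : pd (fun x => f x + g x) i = pd f i + pd g i := funext fun x => pd_add hf.c1 hg.c1 i x
    rw [this]
    exact (hf.d2 i).add (hg.d2 i)⟩

lemma IsH1.const_mul {f : (Fin 3 → ℝ) → ℝ} (hf : IsH1 f) (c : ℝ) :
    IsH1 (fun x => c * f x) :=
  ⟨contDiff_const.mul hf.c1, hf.l2.const_mul c, fun i => by
    have : pd (fun x => c * f x) i = fun x => c * pd f i x :=
      funext fun x => pd_const_mul hf.c1 c i x
    rw [this]
    exact (hf.d2 i).const_mul c⟩

lemma memLp_bdd_mul {p f : (Fin 3 → ℝ) → ℝ} {M : ℝ} (hp : Continuous p) (hM : ∀ x, |p x| ≤ M)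
    (hf : MemLp f 2 muH) : MemLp (fun x => p x * f x) 2 muH := by
  refine (hf.const_mul M).mono (hp.aestronglyMeasurable.mul hf.1)
    (Filter.Eventually.of_forall fun x => ?_)
  have hM0 : 0 ≤ M := (abs_nonneg _).trans (hM x)
  rw [norm_mul, norm_mul, Real.norm_eq_abs, Real.norm_eq_abs M, abs_of_nonneg hM0]
  exact mul_le_mul_of_nonneg_right (hM x) (norm_nonneg _)

lemma IsH1.bdd_mul {p f : (Fin 3 → ℝ) → ℝ} {M : ℝ} (hp : ContDiff ℝ 1 p) (hM : ∀ x, |p x| ≤ M)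
    (hM' : ∀ i x, |pd p i x| ≤ M) (hf : IsH1 f) : IsH1 (fun x => p x * f x) :=
  ⟨hp.mul hf.c1, memLp_bdd_mul hp.continuous hM hf.l2, fun i => by
    have : pd (fun x => p x * f x) i = (fun x => p x * pd f i x) + fun x => pd p i x * f x :=
      funext fun x => pd_mul hp hf.c1 i x
    rw [this]
    exact (memLp_bdd_mul hp.continuous hM (hf.d2 i)).add
      (memLp_bdd_mul (pd_continuous hp i) (hM' i) hf.l2)⟩

lemma exists_cutoff : ∃ (χ : ℕ → (Fin 3 → ℝ) → ℝ) (K : ℝ), 0 ≤ K ∧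
    (∀ n, ContDiff ℝ 1 (χ n)) ∧ (∀ n, HasCompactSupport (χ n)) ∧ (∀ n x, |χ n x| ≤ 1) ∧
    (∀ n i x, |pd (χ n) i x| ≤ K) ∧
    (∀ x, Filter.Tendsto (fun n => χ n x) Filter.atTop (nhds 1)) ∧
    (∀ i x, Filter.Tendsto (fun n => pd (χ n) i x) Filter.atTop (nhds 0)) := by
  let b : ContDiffBump (0 : Fin 3 → ℝ) := ⟨1, 2, by norm_num, by norm_num⟩
  have hb : ContDiff ℝ 1 b := b.contDiff
  obtain ⟨K, hK0, -, hK⟩ := lip_bound hb b.hasCompactSupport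
  have hc := tendsto_one_div_add_atTop_nhds_zero_nat (𝕜 := ℝ)
  have hpd : ∀ (n : ℕ) i x, pd (fun x => b (((1 : ℝ) / (n + 1)) • x)) i x
      = (1 : ℝ) / (n + 1) * pd b i (((1 : ℝ) / (n + 1)) • x) := by
    intro n i x
    have := pd_comp_clm hb (((1 : ℝ) / (n + 1)) • ContinuousLinearMap.id ℝ (Fin 3 → ℝ)) i x
    simp only [smul_apply, ContinuousLinearMap.id_apply, map_smul,
      smul_eq_mul] at this
    exact this
  refine ⟨fun n x => b (((1 : ℝ) / (n + 1)) • x), K, hK0, fun n => ?_, fun n => ?_, fun n x => ?_,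
    fun n i x => ?_, fun x => ?_, fun i x => ?_⟩
  · exact hb.comp (contDiff_const_smul ((1 : ℝ) / (n + 1)))
  · have hp : (0 : ℝ) < 1 / (n + 1) := Nat.one_div_pos_of_nat
    exact b.hasCompactSupport.comp_homeomorph (Homeomorph.smulOfNeZero _ hp.ne')
  · rw [abs_of_nonneg b.nonneg]; exact b.le_one
  · have hp : (0 : ℝ) < 1 / (n + 1) := Nat.one_div_pos_of_nat
    have hp1 : (1 : ℝ) / (n + 1) ≤ 1 := by
      rw [div_le_one (by positivity)]; linarith [(Nat.cast_nonneg n : (0 : ℝ) ≤ n)]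
    rw [hpd, abs_mul, abs_of_pos hp]
    have h1 := hK i (((1 : ℝ) / (n + 1)) • x)
    have h2 := abs_nonneg (pd b i (((1 : ℝ) / (n + 1)) • x))
    nlinarith
  · have h1 : Filter.Tendsto (fun n : ℕ => ((1 : ℝ) / (n + 1)) • x) Filter.atTop (nhds 0) := by
      simpa using hc.smul_const x
    have h2 := (hb.continuous.tendsto 0).comp h1
    rw [b.one_of_mem_closedBall (by simp [b])] at h2
    exact h2
  · simp_rw [hpd]
    refine squeeze_zero_norm (a := fun n : ℕ => (1 : ℝ) / (n + 1) * K) (fun n => ?_) ?_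
    · have hp : (0 : ℝ) < 1 / (n + 1) := Nat.one_div_pos_of_nat
      rw [norm_mul, Real.norm_eq_abs, abs_of_pos hp]
      exact mul_le_mul_of_nonneg_left (hK i _) hp.le
    · simpa using hc.mul_const K

/-- the antisymmetric form vanishes -/
lemma form_zero {f g : (Fin 3 → ℝ) → ℝ} (hf : IsH1 f) (hg : IsH1 g) (a b : Fin 3) (ha : a ≠ 2)
    (hb : b ≠ 2 ∨ ∀ x, x 2 = 0 → g x = 0) :
    ∫ x, pd f a x * pd g b x ∂muH = ∫ x, pd g a x * pd f b x ∂muH := by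
  obtain ⟨χ, K, hK0, hχ, hχc, hχ1, hχK, hχt, hχt'⟩ := exists_cutoff
  have lim : ∀ {f g : (Fin 3 → ℝ) → ℝ} (hf : IsH1 f) (hg : IsH1 g) (a b : Fin 3),
      Filter.Tendsto (fun n => ∫ x, pd (fun y => χ n y * f y) a x * pd (fun y => χ n y * g y) b x
        ∂muH) Filter.atTop (nhds (∫ x, pd f a x * pd g b x ∂muH)) := by
    intro f g hf hg a b
    have bd : ∀ {f : (Fin 3 → ℝ) → ℝ} (hf : IsH1 f) (a : Fin 3) n x,
        |pd (fun y => χ n y * f y) a x| ≤ |pd f a x| + K * |f x| := by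
      intro f hf a n x
      rw [pd_mul (hχ n) hf.c1]
      refine (abs_add_le _ _).trans (add_le_add ?_ ?_)
      · rw [abs_mul]; exact mul_le_of_le_one_left (abs_nonneg _) (hχ1 n x)
      · rw [abs_mul]; exact mul_le_mul_of_nonneg_right (hχK n a x) (abs_nonneg _)
    have tt : ∀ {f : (Fin 3 → ℝ) → ℝ} (hf : IsH1 f) (a : Fin 3) x,
        Filter.Tendsto (fun n => pd (fun y => χ n y * f y) a x) Filter.atTop
          (nhds (pd f a x)) := by
      intro f hf a x
      simp_rw [fun n => pd_mul (hχ n) hf.c1 a x]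
      simpa using ((hχt x).mul_const (pd f a x)).add ((hχt' a x).mul_const (f x))
    have ml : ∀ {f : (Fin 3 → ℝ) → ℝ} (hf : IsH1 f) (a : Fin 3),
        MemLp (fun x => |pd f a x| + K * |f x|) 2 muH := by
      intro f hf a
      exact (hf.d2 a).abs.add (hf.l2.abs.const_mul K)
    apply tendsto_integral_of_dominated_convergence
      (fun x => (|pd f a x| + K * |f x|) * (|pd g b x| + K * |g x|))
    · intro n
      exact ((pd_continuous ((hχ n).mul hf.c1) a).mul
        (pd_continuous ((hχ n).mul hg.c1) b)).aestronglyMeasurable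
    · exact (ml hf a).integrable_mul (ml hg b)
    · intro n
      refine Filter.Eventually.of_forall fun x => ?_
      rw [Real.norm_eq_abs, abs_mul]
      exact mul_le_mul (bd hf a n x) (bd hg b n x) (abs_nonneg _) (by positivity)
    · exact Filter.Eventually.of_forall fun x => (tt hf a x).mul (tt hg b x)
  refine tendsto_nhds_unique (lim hf hg a b) ((lim hg hf a b).congr fun n => ?_)
  refine (form_zero_cc ((hχ n).mul hf.c1) (hχc n).mul_right ((hχ n).mul hg.c1)
    (hχc n).mul_right a b ha ?_).symm
  refine hb.imp id fun h x hx => ?_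
  simp [h x hx]

lemma form_int {f g : (Fin 3 → ℝ) → ℝ} (hf : IsH1 f) (hg : IsH1 g) (a b : Fin 3) :
    Integrable (fun x => pd f a x * pd g b x) muH :=
  (hf.d2 a).integrable_mul (hg.d2 b)

lemma form_zero' {f g : (Fin 3 → ℝ) → ℝ} (hf : IsH1 f) (hg : IsH1 g) (a b : Fin 3) (ha : a ≠ 2)
    (hb : b ≠ 2 ∨ ∀ x, x 2 = 0 → g x = 0) :
    ∫ x, (pd f a x * pd g b x - pd g a x * pd f b x) ∂muH = 0 := by
  rw [integral_sub (form_int hf hg a b) (form_int hg hf a b), form_zero hf hg a b ha hb, sub_self]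

/-! ### Dilation -/

/-- dilation by two in the normal variable -/
noncomputable def dil : (Fin 3 → ℝ) →L[ℝ] (Fin 3 → ℝ) :=
  LinearMap.toContinuousLinearMap (Matrix.toLin' (Matrix.diagonal (![1, 1, 2] : Fin 3 → ℝ)))

lemma dil_apply (x : Fin 3 → ℝ) (i : Fin 3) : dil x i = (![1, 1, 2] : Fin 3 → ℝ) i * x i := by
  simp [dil, Matrix.mulVec_diagonal]

lemma dil_single (i : Fin 3) : dil (Pi.single i 1) = (![1, 1, 2] : Fin 3 → ℝ) i • Pi.single i 1 := by
  ext j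
  rw [dil_apply]
  by_cases h : j = i
  · subst h; simp
  · simp [h]

lemma pd_dil {f : (Fin 3 → ℝ) → ℝ} (hf : ContDiff ℝ 1 f) (i : Fin 3) (x : Fin 3 → ℝ) :
    pd (fun y => f (dil y)) i x = (![1, 1, 2] : Fin 3 → ℝ) i * pd f i (dil x) := by
  rw [pd_comp_clm hf, dil_single, map_smul, smul_eq_mul]
  rfl

lemma map_dil : Measure.map dil muH = ENNReal.ofReal (1 / 2) • muH := by
  have hm : Measurable dil := dil.continuous.measurable
  have h1 : Measure.map dil (volume : Measure (Fin 3 → ℝ)) = ENNReal.ofReal (1 / 2) • volume := by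
    have hd : (Matrix.diagonal (![1, 1, 2] : Fin 3 → ℝ)).det = 2 := by
      simp [Matrix.det_diagonal, Fin.prod_univ_three]
    have := Real.map_matrix_volume_pi_eq_smul_volume_pi
      (M := Matrix.diagonal (![1, 1, 2] : Fin 3 → ℝ)) (by rw [hd]; norm_num)
    rw [hd] at this
    rw [show (1 / 2 : ℝ) = |(2 : ℝ)⁻¹| by norm_num]
    exact this
  have h2 : dil ⁻¹' lowerHalf = lowerHalf := by
    ext x
    simp only [lowerHalf, Set.mem_preimage, Set.mem_ofPred_eq, dil_apply]
    simp
    constructor <;> intro h <;> linarith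
  have h3 := Measure.restrict_map (μ := volume) hm lowerHalf_measurable
  rw [h2, h1, Measure.restrict_smul] at h3
  exact h3.symm

lemma MemLp_dil {f : (Fin 3 → ℝ) → ℝ} (hf : MemLp f 2 muH) :
    MemLp (fun x => f (dil x)) 2 muH := by
  have : MemLp f 2 (Measure.map dil muH) := by
    rw [map_dil]
    exact hf.smul_measure (by simp)
  exact this.comp_of_map dil.continuous.aemeasurable

lemma integral_dil {f : (Fin 3 → ℝ) → ℝ} (hf : Continuous f) :
    ∫ x, f (dil x) ∂muH = 1 / 2 * ∫ x, f x ∂muH := by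
  rw [← integral_map dil.continuous.aemeasurable hf.aestronglyMeasurable, map_dil,
    integral_smul_measure]
  simp

lemma IsH1.dil {f : (Fin 3 → ℝ) → ℝ} (hf : IsH1 f) : IsH1 (fun x => f (dil x)) :=
  ⟨hf.c1.comp (ContinuousLinearMap.contDiff _), MemLp_dil hf.l2, fun i => by
    rw [funext fun x => pd_dil hf.c1 i x]
    exact (MemLp_dil (hf.d2 i)).const_mul _⟩

lemma dil_bdry (x : Fin 3 → ℝ) (hx : x 2 = 0) : dil x = x := by
  ext i
  rw [dil_apply]
  fin_cases i <;> simp [hx]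

/-- pointwise inequality behind the flat Korn inequality -/
lemma korn_pointwise (d e : Fin 3 → Fin 3 → ℝ) :
    (∑ i, ∑ j, d i j ^ 2) + 2 * (d 0 1 * d 1 0 - d 0 0 * d 1 1)
      + 2 * (d 0 2 * d 2 0 - d 0 0 * d 2 2
          - ((-3 * d 0 2 + 4 * e 0 2) * (3 * d 2 0 + (-2) * (2 * e 2 0))
            - (3 * d 0 0 + (-2) * e 0 0) * (-3 * d 2 2 + 4 * (2 * e 2 2))))
      + 2 * (d 1 2 * d 2 1 - d 1 1 * d 2 2
          - ((-3 * d 1 2 + 4 * e 1 2) * (3 * d 2 1 + (-2) * (2 * e 2 1))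
            - (3 * d 1 1 + (-2) * e 1 1) * (-3 * d 2 2 + 4 * (2 * e 2 2))))
      ≤ 400 * (∑ i, ∑ j, ((d i j + d j i) / 2) ^ 2)
        + 400 * (∑ i, ∑ j, ((e i j + e j i) / 2) ^ 2) := by
  have xy : ∀ x y : ℝ, -2 * (x * y) ≤ (x - y) ^ 2 / 2 := fun x y => by
    nlinarith [sq_nonneg (x + y)]
  have uv : ∀ x y : ℝ, 2 * (x * y) ≤ x ^ 2 + y ^ 2 := fun x y => by
    nlinarith [sq_nonneg (x - y)]
  have ab : ∀ x y : ℝ, (x + y) ^ 2 ≤ 2 * x ^ 2 + 2 * y ^ 2 := fun x y => by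
    nlinarith [sq_nonneg (x - y)]
  have a1 := xy (-3 * d 0 2 + 4 * e 0 2) (3 * d 2 0 + (-2) * (2 * e 2 0))
  have a2 := xy (-3 * d 1 2 + 4 * e 1 2) (3 * d 2 1 + (-2) * (2 * e 2 1))
  have b1 := uv (3 * d 0 0 + (-2) * e 0 0) (-3 * d 2 2 + 4 * (2 * e 2 2))
  have b2 := uv (3 * d 1 1 + (-2) * e 1 1) (-3 * d 2 2 + 4 * (2 * e 2 2))
  have c1 := ab (-3 * (d 0 2 + d 2 0)) (4 * (e 0 2 + e 2 0))
  have c2 := ab (-3 * (d 1 2 + d 2 1)) (4 * (e 1 2 + e 2 1))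
  have c3 := ab (3 * d 0 0) ((-2) * e 0 0)
  have c4 := ab (3 * d 1 1) ((-2) * e 1 1)
  have c5 := ab (-3 * d 2 2) (4 * (2 * e 2 2))
  have f1 := sq_nonneg (d 0 0 + d 1 1 + d 2 2)
  simp only [Fin.sum_univ_three]
  have g := fun i j => sq_nonneg (d i j + d j i)
  have g' := fun i j => sq_nonneg (e i j + e j i)
  have k1 : (-3 * d 0 2 + 4 * e 0 2 - (3 * d 2 0 + (-2) * (2 * e 2 0))) ^ 2
    = (-3 * (d 0 2 + d 2 0) + 4 * (e 0 2 + e 2 0)) ^ 2 := by ring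
  have k2 : (-3 * d 1 2 + 4 * e 1 2 - (3 * d 2 1 + (-2) * (2 * e 2 1))) ^ 2
    = (-3 * (d 1 2 + d 2 1) + 4 * (e 1 2 + e 2 1)) ^ 2 := by ring
  rw [k1] at a1
  rw [k2] at a2
  have h1 := a1.trans (div_le_div_of_nonneg_right c1 (by norm_num))
  have h2 := a2.trans (div_le_div_of_nonneg_right c2 (by norm_num))
  have h3 := b1.trans (add_le_add c3 c5)
  have h4 := b2.trans (add_le_add c4 c5)
  clear a1 a2 b1 b2 c1 c2 c3 c4 c5 k1 k2 xy uv ab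
  nlinarith [g 0 0, g 0 1, g 0 2, g 1 1, g 1 2, g 2 2, g' 0 0, g' 0 1, g' 0 2, g' 1 1, g' 1 2,
    g' 2 2]

lemma flat_korn (w : Fin 3 → (Fin 3 → ℝ) → ℝ) (hw : ∀ j, IsH1 (w j)) :
    ∫ x, (∑ i, ∑ j, (pd (w j) i x) ^ 2) ∂muH
      ≤ 600 * ∫ x, (∑ i, ∑ j, ((pd (w j) i x + pd (w i) j x) / 2) ^ 2) ∂muH := by
  -- the auxiliary functions
  have hU : ∀ (a : Fin 3) (p q : ℝ), IsH1 (fun x => p * w a x + q * w a (dil x)) := fun a p q =>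
    ((hw a).const_mul p).add ((hw a).dil.const_mul q)
  have pU : ∀ (a : Fin 3) (p q : ℝ) (i x), pd (fun x => p * w a x + q * w a (dil x)) i x
      = p * pd (w a) i x + q * ((![1, 1, 2] : Fin 3 → ℝ) i * pd (w a) i (dil x)) := by
    intro a p q i x
    rw [pd_add ((hw a).const_mul p).c1 ((hw a).dil.const_mul q).c1, pd_const_mul (hw a).c1,
      pd_const_mul (hw a).dil.c1, pd_dil (hw a).c1]
  have h01 := form_zero' (hw 1) (hw 0) 0 1 (by decide) (Or.inl (by decide))
  have i01 : Integrable (fun x => pd (w 1) 0 x * pd (w 0) 1 x - pd (w 0) 0 x * pd (w 1) 1 x) muH :=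
    (form_int (hw 1) (hw 0) 0 1).sub (form_int (hw 0) (hw 1) 0 1)
  have hG : ∀ a : Fin 3, a ≠ 2 → Integrable (fun x => (pd (w 2) a x * pd (w a) 2 x
        - pd (w a) a x * pd (w 2) 2 x)
        - ((-3 * pd (w 2) a x + 4 * pd (w 2) a (dil x))
            * (3 * pd (w a) 2 x + (-2) * (2 * pd (w a) 2 (dil x)))
          - (3 * pd (w a) a x + (-2) * pd (w a) a (dil x))
            * (-3 * pd (w 2) 2 x + 4 * (2 * pd (w 2) 2 (dil x))))) muH ∧
      ∫ x, ((pd (w 2) a x * pd (w a) 2 x - pd (w a) a x * pd (w 2) 2 x)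
        - ((-3 * pd (w 2) a x + 4 * pd (w 2) a (dil x))
            * (3 * pd (w a) 2 x + (-2) * (2 * pd (w a) 2 (dil x)))
          - (3 * pd (w a) a x + (-2) * pd (w a) a (dil x))
            * (-3 * pd (w 2) 2 x + 4 * (2 * pd (w 2) 2 (dil x))))) ∂muH = 0 := by
    intro a ha
    have hp := hU 2 (-4) 4
    have hq := hU a 2 (-2)
    have hU2 := hU 2 (-3) 4
    have z1 := form_zero' (hw a) hp a 2 ha (Or.inr fun x hx => by rw [dil_bdry x hx]; ring)
    have z2 := form_zero' hU2 hq a 2 ha (Or.inr fun x hx => by rw [dil_bdry x hx]; ring)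
    have j1 := (form_int (hw a) hp a 2).sub (form_int hp (hw a) a 2)
    have j2 := (form_int hU2 hq a 2).sub (form_int hq hU2 a 2)
    have m : (![1, 1, 2] : Fin 3 → ℝ) a = 1 := by
      fin_cases a <;> simp at ha ⊢
    have m2 : (![1, 1, 2] : Fin 3 → ℝ) 2 = 2 := rfl
    have key : (fun x => (pd (w 2) a x * pd (w a) 2 x - pd (w a) a x * pd (w 2) 2 x)
        - ((-3 * pd (w 2) a x + 4 * pd (w 2) a (dil x))
            * (3 * pd (w a) 2 x + (-2) * (2 * pd (w a) 2 (dil x)))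
          - (3 * pd (w a) a x + (-2) * pd (w a) a (dil x))
            * (-3 * pd (w 2) 2 x + 4 * (2 * pd (w 2) 2 (dil x)))))
        = fun x => (pd (w a) a x * pd (fun x => -4 * w 2 x + 4 * w 2 (dil x)) 2 x
            - pd (fun x => -4 * w 2 x + 4 * w 2 (dil x)) a x * pd (w a) 2 x)
          - (pd (fun x => -3 * w 2 x + 4 * w 2 (dil x)) a x
              * pd (fun x => 2 * w a x + -2 * w a (dil x)) 2 x
            - pd (fun x => 2 * w a x + -2 * w a (dil x)) a x
              * pd (fun x => -3 * w 2 x + 4 * w 2 (dil x)) 2 x) := by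
      ext x
      simp only [pU, m, m2]
      ring
    constructor
    · rw [key]; exact j1.sub j2
    · rw [key]
      refine (integral_sub j1 j2).trans ?_
      simp only [Pi.sub_apply]
      rw [z1, z2, sub_zero]
  obtain ⟨iG0, hG0⟩ := hG 0 (by decide)
  obtain ⟨iG1, hG1⟩ := hG 1 (by decide)
  have iD : Integrable (fun x => ∑ i, ∑ j, (pd (w j) i x) ^ 2) muH :=
    integrable_finsetSum _ fun i _ => integrable_finsetSum _ fun j _ => ((hw j).d2 i).integrable_sq
  have iQ : Integrable (fun x => ∑ i, ∑ j, ((pd (w j) i x + pd (w i) j x) / 2) ^ 2) muH :=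
    integrable_finsetSum _ fun i _ => integrable_finsetSum _ fun j _ => by
      have := (((hw j).d2 i).add ((hw i).d2 j)).const_mul (1 / 2)
      refine this.integrable_sq.congr (Filter.Eventually.of_forall fun x => ?_)
      simp only [Pi.add_apply]
      ring
  have iQd : Integrable (fun x => ∑ i, ∑ j, ((pd (w j) i (dil x) + pd (w i) j (dil x)) / 2) ^ 2)
      muH :=
    integrable_finsetSum _ fun i _ => integrable_finsetSum _ fun j _ => by
      have := MemLp_dil ((((hw j).d2 i).add ((hw i).d2 j)).const_mul (1 / 2))
      refine this.integrable_sq.congr (Filter.Eventually.of_forall fun x => ?_)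
      simp only [Pi.add_apply]
      ring
  have cQ : Continuous (fun x => ∑ i, ∑ j, ((pd (w j) i x + pd (w i) j x) / 2) ^ 2) := by
    have := fun i j => pd_continuous (hw j).c1 i
    fun_prop
  have hd := integral_dil cQ
  have mono := integral_mono
    (((iD.add (i01.const_mul 2)).add (iG0.const_mul 2)).add (iG1.const_mul 2))
    ((iQ.const_mul 400).add (iQd.const_mul 400))
    (fun x => korn_pointwise (fun i j => pd (w j) i x) (fun i j => pd (w j) i (dil x)))
  rw [integral_add' ((iD.add (i01.const_mul 2)).add (iG0.const_mul 2)) (iG1.const_mul 2),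
    integral_add' (iD.add (i01.const_mul 2)) (iG0.const_mul 2),
    integral_add' iD (i01.const_mul 2), integral_const_mul,
    integral_const_mul, integral_const_mul, h01, hG0, hG1, integral_add' (iQ.const_mul 400) (iQd.const_mul 400),
    integral_const_mul, integral_const_mul, hd] at mono
  linarith

/-! ### The flattening -/

lemma sq_mul_le {p a M : ℝ} (h : |p| ≤ M) : (p * a) ^ 2 ≤ M ^ 2 * a ^ 2 := by
  rw [mul_pow]
  apply mul_le_mul_of_nonneg_right _ (sq_nonneg a)
  exact sq_le_sq' (abs_le.1 h).1 (abs_le.1 h).2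

lemma entry_le (s : Fin 3 → Fin 3 → ℝ) (i j : Fin 3) : s i j ^ 2 ≤ ∑ i, ∑ j, s i j ^ 2 := by
  refine (Finset.single_le_sum (f := fun j => s i j ^ 2) (fun j _ => sq_nonneg _)
    (Finset.mem_univ j)).trans ?_
  exact Finset.single_le_sum (f := fun i => ∑ j, s i j ^ 2)
    (fun i _ => Finset.sum_nonneg fun j _ => sq_nonneg _) (Finset.mem_univ i)

/-- `1` for tangential indices, `0` for the normal one -/
def eps (j : Fin 3) : ℝ := if j = 2 then 0 else 1

lemma eps_abs (j : Fin 3) : |eps j| ≤ 1 := by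
  unfold eps; split_ifs <;> simp

lemma five_sq (a b c d e : ℝ) : (a + b + c + d + e) ^ 2
    ≤ 5 * (a ^ 2 + b ^ 2 + c ^ 2 + d ^ 2 + e ^ 2) := by
  nlinarith [sq_nonneg (a - b), sq_nonneg (a - c), sq_nonneg (a - d), sq_nonneg (a - e),
    sq_nonneg (b - c), sq_nonneg (b - d), sq_nonneg (b - e), sq_nonneg (c - d), sq_nonneg (c - e),
    sq_nonneg (d - e)]

lemma alg_sym (c₀ M : ℝ) (hc : 0 < c₀) (P : Fin 3 → ℝ) (H A F s : Fin 3 → Fin 3 → ℝ)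
    (v : Fin 3 → ℝ) (hP2 : c₀ ≤ P 2) (hP : ∀ i, |P i| ≤ M) (hH : ∀ i j, |H i j| ≤ M)
    (hF : ∀ i j, F i j = if i = 2 then A 2 j / P 2 else A i j - P i / P 2 * A 2 j)
    (hs : ∀ i j, s i j = (F i j + F j i) / 2) :
    ∑ i, ∑ j, (((eps j * A i j + (P j * A i 2 + H i j * v 2))
        + (eps i * A j i + (P i * A j 2 + H j i * v 2))) / 2) ^ 2
      ≤ 45 * ((1 + M ^ 2) ^ 2 / c₀ + M ^ 2) * ((∑ i, ∑ j, s i j ^ 2) * P 2 + ∑ i, v i ^ 2) := by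
  have hP2' : P 2 ≠ 0 := (hc.trans_le hP2).ne'
  set T := ∑ i, ∑ j, s i j ^ 2 with hT
  have hT0 : 0 ≤ T := Finset.sum_nonneg fun i _ => Finset.sum_nonneg fun j _ => sq_nonneg _
  have hV : v 2 ^ 2 ≤ ∑ i, v i ^ 2 :=
    Finset.single_le_sum (f := fun j => v j ^ 2) (fun j _ => sq_nonneg _) (Finset.mem_univ 2)
  set V := ∑ i, v i ^ 2
  have hA : ∀ i j, A i j = eps i * F i j + P i * F 2 j := by
    intro i j
    rw [hF, hF]
    by_cases h : i = 2
    · subst h; simp [eps]; field_simp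
    · simp [eps, h]; field_simp; ring
  have hM0 : 0 ≤ M := (abs_nonneg _).trans (hP 0)
  have each : ∀ i j, (((eps j * A i j + (P j * A i 2 + H i j * v 2))
        + (eps i * A j i + (P i * A j 2 + H j i * v 2))) / 2) ^ 2
      ≤ 5 * ((1 + M ^ 2) ^ 2 * T + M ^ 2 * V) := by
    intro i j
    have e : ((eps j * A i j + (P j * A i 2 + H i j * v 2))
        + (eps i * A j i + (P i * A j 2 + H j i * v 2))) / 2
        = (eps i * eps j) * s i j + (eps i * P j) * s i 2 + (eps j * P i) * s 2 j
          + (P i * P j) * s 2 2 + ((H i j + H j i) / 2) * v 2 := by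
      rw [hA i j, hA j i, hA i 2, hA j 2, hs, hs, hs, hs]
      ring
    rw [e]
    refine (five_sq _ _ _ _ _).trans ?_
    have b1 : |eps i * eps j| ≤ 1 := by
      rw [abs_mul]; exact mul_le_one₀ (eps_abs i) (abs_nonneg _) (eps_abs j)
    have b2 : ∀ i j, |eps i * P j| ≤ M := fun i j => by
      rw [abs_mul]
      calc |eps i| * |P j| ≤ 1 * M := mul_le_mul (eps_abs i) (hP j) (abs_nonneg _) zero_le_one
        _ = M := one_mul M
    have b4 : |P i * P j| ≤ M * M := by
      rw [abs_mul]; exact mul_le_mul (hP i) (hP j) (abs_nonneg _) hM0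
    have b5 : |(H i j + H j i) / 2| ≤ M := by
      have h1 := abs_le.1 (hH i j)
      have h2 := abs_le.1 (hH j i)
      rw [abs_le]; constructor <;> linarith
    have d1 := (sq_mul_le (a := s i j) b1)
    have d2 := (sq_mul_le (a := s i 2) (b2 i j)).trans
      (mul_le_mul_of_nonneg_left (entry_le s i 2) (sq_nonneg M))
    have d3 := (sq_mul_le (a := s 2 j) (b2 j i)).trans
      (mul_le_mul_of_nonneg_left (entry_le s 2 j) (sq_nonneg M))
    have d4 := (sq_mul_le (a := s 2 2) b4).trans
      (mul_le_mul_of_nonneg_left (entry_le s 2 2) (sq_nonneg (M * M)))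
    have d5 := (sq_mul_le (a := v 2) b5).trans (mul_le_mul_of_nonneg_left hV (sq_nonneg M))
    have d1' := entry_le s i j
    rw [← hT] at d1' d2 d3 d4
    nlinarith
  calc _ ≤ ∑ i : Fin 3, ∑ j : Fin 3, 5 * ((1 + M ^ 2) ^ 2 * T + M ^ 2 * V) :=
        Finset.sum_le_sum fun i _ => Finset.sum_le_sum fun j _ => each i j
    _ = 45 * ((1 + M ^ 2) ^ 2 * T + M ^ 2 * V) := by simp; ring
    _ ≤ _ := by
      have hV0 : 0 ≤ V := (sq_nonneg _).trans hV
      have t1 : T ≤ T * P 2 / c₀ := by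
        rw [le_div_iff₀ hc]; exact mul_le_mul_of_nonneg_left hP2 hT0
      have t2 : (1 + M ^ 2) ^ 2 * T ≤ (1 + M ^ 2) ^ 2 / c₀ * (T * P 2) := by
        calc _ ≤ (1 + M ^ 2) ^ 2 * (T * P 2 / c₀) := mul_le_mul_of_nonneg_left t1 (by positivity)
          _ = _ := by ring
      have t3 : 0 ≤ (1 + M ^ 2) ^ 2 / c₀ * V := by positivity
      have t4 : 0 ≤ M ^ 2 * (T * P 2) := by
        have := hc.trans_le hP2
        positivity
      nlinarith

lemma alg_grad (c₀ M : ℝ) (hc : 0 < c₀) (P : Fin 3 → ℝ) (H A : Fin 3 → Fin 3 → ℝ)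
    (v : Fin 3 → ℝ) (hP2 : c₀ ≤ P 2) (hP : ∀ i, |P i| ≤ M) (hH : ∀ i j, |H i j| ≤ M) :
    ∑ i, ∑ j, A i j ^ 2
      ≤ (27 * (1 + M ^ 2) + 9 * (1 + 3 * M ^ 2) * (2 * (1 + M ^ 2) / c₀ ^ 2)) *
        ((∑ i, ∑ j, (eps j * A i j + (P j * A i 2 + H i j * v 2)) ^ 2) + ∑ i, v i ^ 2) := by
  have hp : 0 < P 2 := hc.trans_le hP2
  set D : Fin 3 → Fin 3 → ℝ := fun i j => eps j * A i j + (P j * A i 2 + H i j * v 2) with hD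
  have hV : v 2 ^ 2 ≤ ∑ i, v i ^ 2 :=
    Finset.single_le_sum (f := fun j => v j ^ 2) (fun j _ => sq_nonneg _) (Finset.mem_univ 2)
  set V := ∑ i, v i ^ 2
  have hE := entry_le D
  change _ ≤ _ * ((∑ i, ∑ j, D i j ^ 2) + V)
  set E := ∑ i, ∑ j, D i j ^ 2
  have hV0 : 0 ≤ V := (sq_nonneg _).trans hV
  have hE0 : 0 ≤ E := (sq_nonneg _).trans (hE 0 0)
  have hHv : ∀ i j, (H i j * v 2) ^ 2 ≤ M ^ 2 * V := fun i j =>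
    (sq_mul_le (hH i j)).trans (mul_le_mul_of_nonneg_left hV (sq_nonneg M))
  -- the normal component
  have h2 : ∀ i, A i 2 ^ 2 ≤ 2 * (1 + M ^ 2) / c₀ ^ 2 * (E + V) := by
    intro i
    have e : P 2 * A i 2 = D i 2 - H i 2 * v 2 := by simp [hD, eps]
    have e2 : (P 2 * A i 2) ^ 2 ≤ 2 * (1 + M ^ 2) * (E + V) := by
      rw [e]
      nlinarith [sq_nonneg (D i 2 + H i 2 * v 2), hHv i 2, hE i 2, mul_nonneg (sq_nonneg M) hE0]
    have e3 : c₀ ^ 2 * A i 2 ^ 2 ≤ (P 2 * A i 2) ^ 2 := by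
      rw [mul_pow]
      exact mul_le_mul_of_nonneg_right (pow_le_pow_left₀ hc.le hP2 2) (sq_nonneg _)
    rw [div_mul_eq_mul_div, le_div_iff₀ (by positivity)]
    linarith
  set N := 2 * (1 + M ^ 2) / c₀ ^ 2 * (E + V) with hN
  have hN0 : 0 ≤ N := by positivity
  have each : ∀ i j, A i j ^ 2 ≤ 3 * (1 + M ^ 2) * (E + V) + (1 + 3 * M ^ 2) * N := by
    intro i j
    by_cases h : j = 2
    · subst h
      have := h2 i
      have : 0 ≤ 3 * (1 + M ^ 2) * (E + V) := by positivity
      nlinarith [mul_nonneg (sq_nonneg M) hN0]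
    · have e : A i j = D i j - H i j * v 2 - P j * A i 2 := by simp [hD, eps, h]; ring
      have e1 : (P j * A i 2) ^ 2 ≤ M ^ 2 * N :=
        (sq_mul_le (hP j)).trans (mul_le_mul_of_nonneg_left (h2 i) (sq_nonneg M))
      have e2 : ∀ a b c : ℝ, (a - b - c) ^ 2 ≤ 3 * (a ^ 2 + b ^ 2 + c ^ 2) := fun a b c => by
        nlinarith [sq_nonneg (a + b), sq_nonneg (a + c), sq_nonneg (b - c)]
      rw [e]
      refine (e2 _ _ _).trans ?_
      nlinarith [hHv i j, hE i j, mul_nonneg (sq_nonneg M) hE0]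
  calc _ ≤ ∑ i : Fin 3, ∑ j : Fin 3, (3 * (1 + M ^ 2) * (E + V) + (1 + 3 * M ^ 2) * N) :=
        Finset.sum_le_sum fun i _ => Finset.sum_le_sum fun j _ => each i j
    _ = 9 * (3 * (1 + M ^ 2) * (E + V) + (1 + 3 * M ^ 2) * N) := by simp; ring
    _ ≤ _ := by
      rw [hN]; apply le_of_eq; ring

lemma memLp_of_sq_le {f g : (Fin 3 → ℝ) → ℝ} (hf : Continuous f) (hg : Integrable g muH)
    (h : ∀ x, f x ^ 2 ≤ g x) : MemLp f 2 muH := by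
  rw [memLp_two_iff_integrable_sq hf.aestronglyMeasurable]
  refine hg.mono' (hf.pow 2).aestronglyMeasurable (Filter.Eventually.of_forall fun x => ?_)
  rw [Real.norm_eq_abs, abs_of_nonneg (sq_nonneg _)]
  exact h x

/-- Korn-type inequality on the flattened half space: if `∂_zφ ≥ c₀ > 0`
and `‖∇φ‖_∞ + ‖∇²φ‖_∞ ≤ 1/c₀`, then there is `Λ₀ = Λ(1/c₀) > 0` with
`‖∇v‖²_{L²} ≤ Λ₀ (∫ |S^φ v|² ∂_zφ + ‖v‖²_{L²})` for all `v ∈ H¹(ℝ³₋)`. -/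
theorem korn_inequality_flattened (c₀ : ℝ) (hc₀ : 0 < c₀) :
    ∃ Λ₀ > (0 : ℝ), ∀ φ : (Fin 3 → ℝ) → ℝ, ContDiff ℝ (⊤ : ℕ∞) φ →
      (∀ x, c₀ ≤ pd φ 2 x) →
      (∀ x, ‖fderiv ℝ φ x‖ + ‖fderiv ℝ (fderiv ℝ φ) x‖ ≤ 1 / c₀) →
      ∀ v : (Fin 3 → ℝ) → Fin 3 → ℝ,
        (∀ i, ContDiff ℝ 1 (fun x => v x i)) →
        IntegrableOn (fun x => ∑ i, ∑ j, (pd (fun y => v y j) i x) ^ 2) lowerHalf →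
        IntegrableOn (fun x => ∑ i, (v x i) ^ 2) lowerHalf →
        IntegrableOn (fun x => (∑ i, ∑ j, (symF φ v i j x) ^ 2) * pd φ 2 x) lowerHalf →
        (∫ x in lowerHalf, ∑ i, ∑ j, (pd (fun y => v y j) i x) ^ 2)
          ≤ Λ₀ * ((∫ x in lowerHalf, (∑ i, ∑ j, (symF φ v i j x) ^ 2) * pd φ 2 x)
              + ∫ x in lowerHalf, ∑ i, (v x i) ^ 2) := by
  obtain ⟨M, hM⟩ : ∃ M, M = 1 / c₀ := ⟨_, rfl⟩
  obtain ⟨C1, hC1⟩ : ∃ C1, C1 = 45 * ((1 + M ^ 2) ^ 2 / c₀ + M ^ 2) := ⟨_, rfl⟩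
  obtain ⟨C2, hC2⟩ : ∃ C2, C2 = 27 * (1 + M ^ 2) + 9 * (1 + 3 * M ^ 2) * (2 * (1 + M ^ 2) / c₀ ^ 2) :=
    ⟨_, rfl⟩
  have hC1p : 0 < C1 := by rw [hC1]; positivity
  have hC2p : 0 < C2 := by rw [hC2]; positivity
  refine ⟨C2 * (600 * C1 + 1), by positivity, ?_⟩
  intro φ hφ hφ2 hφM v hv hvD hvL hvS
  rw [← hM] at hφM
  have hφ2' : ContDiff ℝ 2 φ := hφ.of_le (by
    exact WithTop.coe_le_coe.2 (le_top : ((2 : ℕ) : ℕ∞) ≤ ⊤))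
  have hfd : ContDiff ℝ 1 (fderiv ℝ φ) := hφ2'.fderiv_right (by norm_num)
  have hP1 : ∀ j, ContDiff ℝ 1 (pd φ j) := fun j => hfd.clm_apply contDiff_const
  have hPb : ∀ j x, |pd φ j x| ≤ M := by
    intro j x
    have := (fderiv ℝ φ x).le_opNorm (Pi.single j 1)
    rw [norm_single_one, mul_one] at this
    have h2 := hφM x
    have h3 := norm_nonneg (fderiv ℝ (fderiv ℝ φ) x)
    exact this.trans (by linarith)
  have hHb : ∀ j i x, |pd (pd φ j) i x| ≤ M := by
    intro j i x
    have e : pd (pd φ j) i x = fderiv ℝ (fderiv ℝ φ) x (Pi.single i 1) (Pi.single j 1) := by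
      have h1 : HasFDerivAt (pd φ j) _ x :=
        (hfd.differentiable (by norm_num) x).hasFDerivAt.clm_apply
          (hasFDerivAt_const (Pi.single j 1 : Fin 3 → ℝ) x)
      unfold pd at h1 ⊢
      rw [h1.fderiv]
      simp
    rw [e]
    have h1 := (fderiv ℝ (fderiv ℝ φ) x).le_opNorm₂ (Pi.single i 1) (Pi.single j 1)
    rw [norm_single_one, norm_single_one, mul_one, mul_one] at h1
    have h2 := hφM x
    have h3 := norm_nonneg (fderiv ℝ φ x)
    exact h1.trans (by linarith)
  have hvH : ∀ j, IsH1 (fun x => v x j) := fun j =>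
    ⟨hv j, memLp_of_sq_le (hv j).continuous hvL fun x =>
        Finset.single_le_sum (f := fun j => v x j ^ 2) (fun j _ => sq_nonneg _)
          (Finset.mem_univ j),
      fun i => memLp_of_sq_le (pd_continuous (hv j) i) hvD fun x =>
        entry_le (fun i j => pd (fun y => v y j) i x) i j⟩
  have hpH : ∀ j, IsH1 (fun x => pd φ j x * v x 2) := fun j =>
    (hvH 2).bdd_mul (hP1 j) (hPb j) (hHb j)
  let w : Fin 3 → (Fin 3 → ℝ) → ℝ := fun j x => eps j * v x j + pd φ j x * v x 2
  have hw : ∀ j, IsH1 (w j) := fun j => ((hvH j).const_mul (eps j)).add (hpH j)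
  have pw : ∀ j i x, pd (w j) i x = eps j * pd (fun y => v y j) i x
      + (pd φ j x * pd (fun y => v y 2) i x + pd (pd φ j) i x * v x 2) := by
    intro j i x
    have h1 := pd_add ((hvH j).const_mul (eps j)).c1 (hpH j).c1 i x
    rw [pd_const_mul (hv j), pd_mul (hP1 j) (hv 2)] at h1
    exact h1
  have iD : Integrable (fun x => ∑ i, ∑ j, (pd (w j) i x) ^ 2) muH :=
    integrable_finsetSum _ fun i _ => integrable_finsetSum _ fun j _ => ((hw j).d2 i).integrable_sq
  have iQ : Integrable (fun x => ∑ i, ∑ j, ((pd (w j) i x + pd (w i) j x) / 2) ^ 2) muH :=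
    integrable_finsetSum _ fun i _ => integrable_finsetSum _ fun j _ => by
      have := (((hw j).d2 i).add ((hw i).d2 j)).const_mul (1 / 2)
      refine this.integrable_sq.congr (Filter.Eventually.of_forall fun x => ?_)
      simp only [Pi.add_apply]
      ring
  have korn := flat_korn w hw
  have s1 : ∫ x, (∑ i, ∑ j, (pd (fun y => v y j) i x) ^ 2) ∂muH
      ≤ C2 * (∫ x, (∑ i, ∑ j, (pd (w j) i x) ^ 2) ∂muH + ∫ x, (∑ i, (v x i) ^ 2) ∂muH) := by
    rw [← integral_add iD hvL, ← integral_const_mul]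
    refine integral_mono hvD ((iD.add hvL).const_mul C2) fun x => ?_
    have := alg_grad c₀ M hc₀ (fun j => pd φ j x) (fun i j => pd (pd φ j) i x)
      (fun i j => pd (fun y => v y j) i x) (v x) (hφ2 x) (fun j => hPb j x)
      (fun i j => hHb j i x)
    rw [← hC2] at this
    simp only [← pw] at this
    exact this
  have s2 : ∫ x, (∑ i, ∑ j, ((pd (w j) i x + pd (w i) j x) / 2) ^ 2) ∂muH
      ≤ C1 * (∫ x, (∑ i, ∑ j, (symF φ v i j x) ^ 2) * pd φ 2 x ∂muH
        + ∫ x, (∑ i, (v x i) ^ 2) ∂muH) := by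
    rw [← integral_add hvS hvL, ← integral_const_mul]
    refine integral_mono iQ ((hvS.add hvL).const_mul C1) fun x => ?_
    have := alg_sym c₀ M hc₀ (fun j => pd φ j x) (fun i j => pd (pd φ j) i x)
      (fun i j => pd (fun y => v y j) i x) (fun i j => pdF φ (fun y => v y j) i x)
      (fun i j => symF φ v i j x) (v x) (hφ2 x) (fun j => hPb j x)
      (fun i j => hHb j i x) (fun i j => rfl) (fun i j => rfl)
    rw [← hC1] at this
    simp only [← pw] at this
    exact this
  have hV0 : 0 ≤ ∫ x, (∑ i, (v x i) ^ 2) ∂muH :=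
    integral_nonneg fun x => Finset.sum_nonneg fun i _ => sq_nonneg _
  have hS0 : 0 ≤ ∫ x, (∑ i, ∑ j, (symF φ v i j x) ^ 2) * pd φ 2 x ∂muH :=
    integral_nonneg fun x => mul_nonneg
      (Finset.sum_nonneg fun i _ => Finset.sum_nonneg fun j _ => sq_nonneg _)
      (hc₀.le.trans (hφ2 x))
  refine s1.trans ?_
  rw [mul_assoc]
  refine mul_le_mul_of_nonneg_left ?_ hC2p.le
  calc _ ≤ 600 * (C1 * (∫ x, (∑ i, ∑ j, (symF φ v i j x) ^ 2) * pd φ 2 x ∂muH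
        + ∫ x, (∑ i, (v x i) ^ 2) ∂muH)) + ∫ x, (∑ i, (v x i) ^ 2) ∂muH := by
        linarith [mul_le_mul_of_nonneg_left s2 (by norm_num : (0 : ℝ) ≤ 600)]
    _ ≤ _ := by linarith
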